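/- Let R be a star ring and α : R ≃+* R a ring automorphism commuting with the involution, i.e. star(α(b)) = α(star(b)) for all b ∈ R. Equip the finitely supported functions ℤ →₀ R with the skew convolution (f ⋆ g)(k) = ∑_{l} f(l) · α^l(g(k − l)), and define σ(f)(k) = α^k(star(f(−k))). Then σ is an involutive anti-automorphism of the convolution algebra: σ(σ(f)) = f and σ(f ⋆ g) = σ(g) ⋆ σ(f) for all finitely supported f, g : ℤ → R, and σ is additive. -/

import Mathlib

/-- The integer powers of a ring automorphism commuting with `star` commute with `star`. -/
lemma RingAut.star_zpow_apply {R : Type*} [Ring R] [StarRing R] (α : RingAut R)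
    (hstar : ∀ b : R, star (α b) = α (star b)) (k : ℤ) (b : R) :
    star ((α ^ k : RingAut R) b) = (α ^ k : RingAut R) (star b) := by
  induction k generalizing b with
  | zero => simp
  | succ n ih => simp only [zpow_add_one, RingAut.mul_apply, ih, hstar]
  | pred n ih =>
    have hinv : star (α⁻¹ b) = α⁻¹ (star b) := by
      apply α.injective
      rw [← hstar, ← RingAut.mul_apply, ← RingAut.mul_apply, mul_inv_cancel]
      rfl
    simp only [zpow_sub_one, RingAut.mul_apply, ih, hinv]

/-- for a star ring `R` and a ring automorphism `α` commuting with
the involution, the map `σ(f)(k) = α^k(star(f(−k)))` is an additive involutive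
anti-automorphism of the skew convolution algebra of finitely supported
functions `ℤ →₀ R`. -/
theorem stmt6 {R : Type*} [Ring R] [StarRing R] (α : RingAut R)
    (hstar : ∀ b : R, star (α b) = α (star b))
    (conv : (ℤ →₀ R) → (ℤ →₀ R) → (ℤ →₀ R))
    (hconv : ∀ (f g : ℤ →₀ R) (k : ℤ),
      conv f g k = ∑ l ∈ f.support, f l * (α ^ l : RingAut R) (g (k - l)))
    (σ : (ℤ →₀ R) → (ℤ →₀ R))
    (hσ : ∀ (f : ℤ →₀ R) (k : ℤ), σ f k = (α ^ k : RingAut R) (star (f (-k)))) :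
    (∀ f : ℤ →₀ R, σ (σ f) = f) ∧
    (∀ f g : ℤ →₀ R, σ (conv f g) = conv (σ g) (σ f)) ∧
    (∀ f g : ℤ →₀ R, σ (f + g) = σ f + σ g) := by
  have zpow_zpow_apply (m n : ℤ) (b : R) :
      (α ^ m : RingAut R) ((α ^ n : RingAut R) b) = (α ^ (m + n) : RingAut R) b := by
    rw [zpow_add, RingAut.mul_apply]
  refine ⟨fun f ↦ ?_, fun f g ↦ ?_, fun f g ↦ ?_⟩
  · ext k
    simp only [hσ, RingAut.star_zpow_apply α hstar, zpow_zpow_apply, star_star, neg_neg,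
      add_neg_cancel, zpow_zero, RingAut.one_apply]
  · have conv_eq_finsum (f g : ℤ →₀ R) (k : ℤ) :
        conv f g k = ∑ᶠ l, f l * (α ^ l : RingAut R) (g (k - l)) := by
      rw [hconv, finsum_eq_sum_of_support_subset]
      intro l hl
      simpa using left_ne_zero_of_mul hl
    ext k
    rw [conv_eq_finsum, ← finsum_comp_equiv (Equiv.addLeft k), hσ, hconv, star_sum, map_sum,
      finsum_eq_sum_of_support_subset (s := f.support)]
    · refine Finset.sum_congr rfl fun l _ ↦ ?_
      simp only [hσ, Equiv.coe_addLeft, star_mul, map_mul, RingAut.star_zpow_apply α hstar,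
        zpow_zpow_apply, neg_add', add_neg_cancel_right, sub_add_cancel_left, neg_neg]
    · intro l hl
      have hf := right_ne_zero_of_mul hl
      contrapose! hf
      simp_all
  · ext k
    simp only [hσ, Finsupp.add_apply, star_add, map_add]
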